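/- arXiv:2605.28314 — 2 statements merged into one kernel-verified Lean document; each statement's English description precedes it below -/
import Mathlib

section
/- Dimension of the space of homogeneous polynomial solutions of 𝓛: let n ≥ 1 and let ℋ_k := {P ∈ 𝒫_k : 𝓛 P = 0}, where 𝒫_k is the space of homogeneous polynomials of total degree k in R = MvPolynomial (Fin n ⊕ Fin n) ℂ. Then for k ≥ 2, dim_ℂ ℋ_k = C(2n + k − 1, 2n − 1) − C(2n + k − 3, 2n − 1) (binomial coefficients); moreover dim_ℂ ℋ_0 = 1 and dim_ℂ ℋ_1 = 2n. -/
noncomputable section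

open MvPolynomial

/-- The ultrahyperbolic operator `𝓛 = Σ_j ∂_{z_j}²` acting on polynomials in the
variables `Z_j = X (Sum.inl j)` (for `z_j`) and `W_j = X (Sum.inr j)` (for `z̄_j`):
since `∂_{z_j}` acts as `2 · pderiv (Sum.inr j)`, we have
`𝓛 P = 4 · Σ_j ∂_{W_j}² P`. -/
def UH (n : ℕ) (P : MvPolynomial (Fin n ⊕ Fin n) ℂ) : MvPolynomial (Fin n ⊕ Fin n) ℂ :=
  (4 : ℂ) • ∑ j : Fin n, pderiv (Sum.inr j) (pderiv (Sum.inr j) P)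

/-- The ultrahyperbolic operator `𝓛` as a ℂ-linear map. -/
def UHlin (n : ℕ) :
    MvPolynomial (Fin n ⊕ Fin n) ℂ →ₗ[ℂ] MvPolynomial (Fin n ⊕ Fin n) ℂ :=
  (4 : ℂ) • ∑ j : Fin n,
    ((pderiv (Sum.inr j)).toLinearMap ∘ₗ (pderiv (Sum.inr j)).toLinearMap)

/-- The space `ℋ_k` of homogeneous polynomial solutions of `𝓛` of degree `k`. -/
def Hk (n k : ℕ) : Submodule ℂ (MvPolynomial (Fin n ⊕ Fin n) ℂ) :=
  homogeneousSubmodule (Fin n ⊕ Fin n) ℂ k ⊓ LinearMap.ker (UHlin n)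

namespace MvPolynomial

section Dimension

variable {σ K : Type*} [Fintype σ] [Field K]

instance finiteDimensional_homogeneousSubmodule (k : ℕ) :
    FiniteDimensional K (homogeneousSubmodule σ K k) :=
  Module.Finite.iff_fg.mpr (homogeneousSubmodule_fg σ K k)

theorem finrank_homogeneousSubmodule (k : ℕ) :
    Module.finrank K (homogeneousSubmodule σ K k) = (Fintype.card σ + k - 1).choose k := by
  classical
  have e : {d : σ →₀ ℕ | d.degree = k} ≃ Sym σ k := (Sym.equivNatSum σ k).symm
  rw [← Sym.card_sym_eq_choose, ← Nat.card_eq_fintype_card, ← Nat.card_congr e,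
    homogeneousSubmodule_eq_finsupp_supported]
  exact Module.finrank_eq_nat_card_basis (basisRestrictSupport K {d : σ →₀ ℕ | d.degree = k})

end Dimension

section Antiderivative

variable {σ K : Type*} [Field K]

/-- The antiderivative in the variable `X i` without terms free of `X i`. -/
def antideriv (i : σ) : MvPolynomial σ K →ₗ[K] MvPolynomial σ K :=
  (basisMonomials σ K).constr K fun s ↦ monomial (s + Finsupp.single i 1) ((s i + 1 : K)⁻¹)

theorem antideriv_monomial (i : σ) (s : σ →₀ ℕ) (a : K) :
    antideriv i (monomial s a) = monomial (s + Finsupp.single i 1) (a * (s i + 1 : K)⁻¹) := by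
  have h := (basisMonomials σ K).constr_basis K
    (fun s ↦ monomial (s + Finsupp.single i 1) ((s i + 1 : K)⁻¹)) s
  rw [coe_basisMonomials] at h
  rw [show monomial s a = a • monomial s (1 : K) by simp [smul_monomial], map_smul, antideriv, h,
    smul_monomial, smul_eq_mul]

theorem pderiv_antideriv_self [CharZero K] (i : σ) (p : MvPolynomial σ K) :
    pderiv i (antideriv i p) = p := by
  rw [p.as_sum]
  simp only [map_sum]
  refine Finset.sum_congr rfl fun s _ ↦ ?_
  rw [antideriv_monomial, pderiv_monomial, add_tsub_cancel_right, Finsupp.add_apply,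
    Finsupp.single_eq_same, Nat.cast_add, Nat.cast_one,
    inv_mul_cancel_right₀ (Nat.cast_add_one_ne_zero (s i))]

theorem pderiv_antideriv_of_ne {i j : σ} (hij : j ≠ i) (p : MvPolynomial σ K) :
    pderiv j (antideriv i p) = antideriv i (pderiv j p) := by
  classical
  rw [p.as_sum]
  simp only [map_sum]
  refine Finset.sum_congr rfl fun s _ ↦ ?_
  have hs : s + Finsupp.single i 1 - Finsupp.single j 1 =
      s - Finsupp.single j 1 + Finsupp.single i 1 := by
    ext l
    simp only [Finsupp.tsub_apply, Finsupp.add_apply, Finsupp.single_apply]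
    split_ifs <;> grind
  rw [antideriv_monomial, pderiv_monomial, pderiv_monomial, antideriv_monomial, hs]
  simp [hij, hij.symm, mul_right_comm]

theorem IsHomogeneous.antideriv (i : σ) {p : MvPolynomial σ K} {k : ℕ} (hp : p.IsHomogeneous k) :
    (antideriv i p).IsHomogeneous (k + 1) := by
  rw [p.as_sum, map_sum]
  refine IsHomogeneous.sum _ _ _ fun s hs ↦ ?_
  rw [antideriv_monomial]
  refine isHomogeneous_monomial _ ?_
  have := hp (mem_support_iff.mp hs)
  rw [map_add, Finsupp.degree_single, Finsupp.degree_eq_weight_one, ← this]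
  rfl

end Antiderivative

section SumSqPDeriv

variable {σ K : Type*} [Field K]

/-- The Laplacian in the variables of `t`. -/
def sumSqPDeriv (t : Finset σ) : MvPolynomial σ K →ₗ[K] MvPolynomial σ K :=
  ∑ j ∈ t, (pderiv j).toLinearMap ∘ₗ (pderiv j).toLinearMap

theorem sumSqPDeriv_apply (t : Finset σ) (p : MvPolynomial σ K) :
    sumSqPDeriv t p = ∑ j ∈ t, pderiv j (pderiv j p) := by
  simp [sumSqPDeriv]

theorem IsHomogeneous.sumSqPDeriv (t : Finset σ) {p : MvPolynomial σ K} {k : ℕ}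
    (hp : p.IsHomogeneous k) : (sumSqPDeriv t p).IsHomogeneous (k - 2) := by
  rw [sumSqPDeriv_apply]
  exact IsHomogeneous.sum _ _ _ fun j _ ↦ hp.pderiv.pderiv

theorem IsHomogeneous.sumSqPDeriv_eq_zero (t : Finset σ) {p : MvPolynomial σ K} {k : ℕ}
    (hp : p.IsHomogeneous k) (hk : k < 2) : MvPolynomial.sumSqPDeriv t p = 0 := by
  rw [sumSqPDeriv_apply]
  refine Finset.sum_eq_zero fun j _ ↦ ?_
  have h : (pderiv j p).IsHomogeneous 0 := by
    have := hp.pderiv (i := j)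
    rwa [show k - 1 = 0 by omega] at this
  rw [← totalDegree_zero_iff_isHomogeneous, totalDegree_eq_zero_iff_eq_C] at h
  rw [h, pderiv_C]

theorem IsHomogeneous.exists_sumSqPDeriv_pow_eq_zero (t : Finset σ) {p : MvPolynomial σ K} {k : ℕ}
    (hp : p.IsHomogeneous k) : ∃ m, (MvPolynomial.sumSqPDeriv t ^ m) p = 0 := by
  induction k using Nat.strong_induction_on generalizing p with
  | _ k ih =>
    rcases lt_or_ge k 2 with hk | hk
    · exact ⟨1, by simpa using hp.sumSqPDeriv_eq_zero t hk⟩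
    · obtain ⟨m, hm⟩ := ih (k - 2) (by omega) (hp.sumSqPDeriv t)
      exact ⟨m + 1, by rwa [pow_succ]⟩

theorem sumSqPDeriv_antideriv {t : Finset σ} {i : σ} (hi : i ∉ t) (p : MvPolynomial σ K) :
    sumSqPDeriv t (antideriv i p) = antideriv i (sumSqPDeriv t p) := by
  rw [sumSqPDeriv_apply, sumSqPDeriv_apply, map_sum]
  refine Finset.sum_congr rfl fun j hj ↦ ?_
  have hij : j ≠ i := fun h ↦ hi (h ▸ hj)
  rw [pderiv_antideriv_of_ne hij, pderiv_antideriv_of_ne hij]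

/-- The Laplacian in a nonempty set of variables maps homogeneous polynomials of degree `k + 2`
onto those of degree `k`. -/
theorem IsHomogeneous.exists_sumSqPDeriv_eq [CharZero K] {t : Finset σ} (ht : t.Nonempty)
    {p : MvPolynomial σ K} {k : ℕ} (hp : p.IsHomogeneous k) :
    ∃ q : MvPolynomial σ K, q.IsHomogeneous (k + 2) ∧ MvPolynomial.sumSqPDeriv t q = p := by
  classical
  obtain ⟨i, hi⟩ := ht
  set D : MvPolynomial σ K →ₗ[K] MvPolynomial σ K := MvPolynomial.sumSqPDeriv (t.erase i) with hD
  have hcomm (q : MvPolynomial σ K) :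
      D (MvPolynomial.antideriv i q) = MvPolynomial.antideriv i (D q) :=
    sumSqPDeriv_antideriv (Finset.notMem_erase i t) q
  have hpow (m : ℕ) (q : MvPolynomial σ K) :
      (D ^ m) (MvPolynomial.antideriv i q) = MvPolynomial.antideriv i ((D ^ m) q) := by
    induction m generalizing q with
    | zero => simp
    | succ m ih => rw [pow_succ, Module.End.mul_apply, Module.End.mul_apply, hcomm, ih]
  have hsplit (q : MvPolynomial σ K) :
      MvPolynomial.sumSqPDeriv t (MvPolynomial.antideriv i (MvPolynomial.antideriv i q)) =
        q + MvPolynomial.antideriv i (MvPolynomial.antideriv i (D q)) := by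
    rw [sumSqPDeriv_apply, ← Finset.add_sum_erase t _ hi, ← sumSqPDeriv_apply,
      pderiv_antideriv_self, pderiv_antideriv_self, ← hD, hcomm, hcomm]
  obtain ⟨m, hm⟩ := hp.exists_sumSqPDeriv_pow_eq_zero (t.erase i)
  rw [← hD] at hm
  induction m generalizing p with
  | zero => exact ⟨0, isHomogeneous_zero .., by simpa using hm.symm⟩
  | succ m ih =>
    have hr : (MvPolynomial.antideriv i (MvPolynomial.antideriv i (D p))).IsHomogeneous k := by
      rcases lt_or_ge k 2 with hk | hk
      · rw [hD, hp.sumSqPDeriv_eq_zero _ hk, map_zero, map_zero]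
        exact isHomogeneous_zero ..
      · have := ((hp.sumSqPDeriv (t.erase i)).antideriv i).antideriv i
        rwa [show k - 2 + 1 + 1 = k by omega] at this
    rw [pow_succ, Module.End.mul_apply] at hm
    obtain ⟨q, hq, hqr⟩ := ih hr (by rw [hpow, hpow, hm, map_zero, map_zero])
    refine ⟨MvPolynomial.antideriv i (MvPolynomial.antideriv i p) - q,
      ((hp.antideriv i).antideriv i).sub hq, ?_⟩
    rw [map_sub, hsplit, hqr, add_sub_cancel_right]

end SumSqPDeriv

end MvPolynomial

theorem UHlin_eq_sumSqPDeriv (n : ℕ) :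
    UHlin n = (4 : ℂ) • sumSqPDeriv (Finset.univ.map Function.Embedding.inr) := by
  simp [UHlin, sumSqPDeriv]

theorem Hk_eq_homogeneousSubmodule (n : ℕ) {k : ℕ} (hk : k < 2) :
    Hk n k = homogeneousSubmodule (Fin n ⊕ Fin n) ℂ k := by
  refine inf_eq_left.mpr fun p hp ↦ ?_
  rw [LinearMap.mem_ker, UHlin_eq_sumSqPDeriv, LinearMap.smul_apply,
    IsHomogeneous.sumSqPDeriv_eq_zero _ hp hk, smul_zero]

theorem map_UHlin_homogeneousSubmodule {n : ℕ} (hn : 1 ≤ n) (k : ℕ) :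
    (homogeneousSubmodule (Fin n ⊕ Fin n) ℂ (k + 2)).map (UHlin n) =
      homogeneousSubmodule (Fin n ⊕ Fin n) ℂ k := by
  have : NeZero n := ⟨by omega⟩
  rw [UHlin_eq_sumSqPDeriv, Submodule.map_smul _ _ _ (by norm_num)]
  refine le_antisymm (Submodule.map_le_iff_le_comap.mpr fun p hp ↦ ?_) fun p hp ↦ ?_
  · exact IsHomogeneous.sumSqPDeriv _ hp
  · exact IsHomogeneous.exists_sumSqPDeriv_eq (by simp) hp

theorem finrank_homogeneousSubmodule_add_finrank_Hk {n : ℕ} (hn : 1 ≤ n) (k : ℕ) :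
    Module.finrank ℂ (homogeneousSubmodule (Fin n ⊕ Fin n) ℂ k) +
        Module.finrank ℂ (Hk n (k + 2)) =
      Module.finrank ℂ (homogeneousSubmodule (Fin n ⊕ Fin n) ℂ (k + 2)) := by
  have h := LinearMap.finrank_range_add_finrank_ker
    (UHlin n ∘ₗ (homogeneousSubmodule (Fin n ⊕ Fin n) ℂ (k + 2)).subtype)
  rw [LinearMap.range_comp, Submodule.range_subtype, map_UHlin_homogeneousSubmodule hn,
    LinearMap.ker_comp] at h
  rw [Hk, ← Submodule.map_comap_subtype, Submodule.finrank_map_subtype_eq, h]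

/-- Dimension of the space of homogeneous polynomial solutions of `𝓛`:
for `k ≥ 2`, `dim ℋ_k = C(2n+k−1, 2n−1) − C(2n+k−3, 2n−1)`; moreover
`dim ℋ_0 = 1` and `dim ℋ_1 = 2n`. -/
theorem dim_Hk (n : ℕ) (hn : 1 ≤ n) :
    (∀ k, 2 ≤ k → Module.finrank ℂ (Hk n k) =
      Nat.choose (2 * n + k - 1) (2 * n - 1) - Nat.choose (2 * n + k - 3) (2 * n - 1)) ∧
    Module.finrank ℂ (Hk n 0) = 1 ∧
    Module.finrank ℂ (Hk n 1) = 2 * n := by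
  refine ⟨fun k hk ↦ ?_, ?_, ?_⟩
  · obtain ⟨k, rfl⟩ := Nat.exists_eq_add_of_le' hk
    have h := finrank_homogeneousSubmodule_add_finrank_Hk hn k
    simp only [finrank_homogeneousSubmodule, Fintype.card_sum, Fintype.card_fin, ← two_mul] at h
    rw [Nat.choose_symm_of_eq_add (show 2 * n + k - 1 = k + (2 * n - 1) by omega),
      Nat.choose_symm_of_eq_add (show 2 * n + (k + 2) - 1 = (k + 2) + (2 * n - 1) by omega)] at h
    rw [show 2 * n + (k + 2) - 3 = 2 * n + k - 1 by omega]
    omega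
  · rw [Hk_eq_homogeneousSubmodule n (by norm_num), finrank_homogeneousSubmodule,
      Nat.choose_zero_right]
  · rw [Hk_eq_homogeneousSubmodule n (by norm_num), finrank_homogeneousSubmodule]
    simp [two_mul]
end
end

section
/- Surjectivity of the ultrahyperbolic operator on homogeneous polynomials: let n ≥ 1 and k ≥ 2. For every homogeneous polynomial Q of total degree k − 2 in R = MvPolynomial (Fin n ⊕ Fin n) ℂ there exists a homogeneous polynomial P of total degree k with 𝓛 P = Q; that is, 𝓛 : 𝒫_k → 𝒫_{k−2} is surjective. -/
noncomputable section

open MvPolynomial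

namespace MvPolynomial

variable {σ K : Type*} [Field K]

/-- The sum of the second partial derivatives in the variables from `s`, as a linear map. -/
def partialLaplacian (K : Type*) [Field K] (s : Finset σ) :
    MvPolynomial σ K →ₗ[K] MvPolynomial σ K :=
  ∑ j ∈ s, (pderiv j).toLinearMap ∘ₗ (pderiv j).toLinearMap

theorem partialLaplacian_apply (s : Finset σ) (P : MvPolynomial σ K) :
    partialLaplacian K s P = ∑ j ∈ s, pderiv j (pderiv j P) := by
  simp [partialLaplacian]

theorem monomial_mem_map_partialLaplacian [CharZero K] {s : Finset σ} {i : σ} (hi : i ∈ s) (k : ℕ)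
    (d : σ →₀ ℕ) (hd : d.degree = k) (c : K) :
    monomial d c ∈ (homogeneousSubmodule σ K (k + 2)).map (partialLaplacian K s) := by
  classical
  induction h : k - d i using Nat.strong_induction_on generalizing d c with
  | _ e ih =>
    set a : K := ((d i + 2 : ℕ) : K) * ((d i + 1 : ℕ) : K) with ha
    have ha0 : a ≠ 0 :=
      mul_ne_zero (Nat.cast_ne_zero.mpr (by omega)) (Nat.cast_ne_zero.mpr (by omega))
    set M : MvPolynomial σ K := monomial (d + Finsupp.single i 2) (c / a) with hM
    have hM_mem : M ∈ homogeneousSubmodule σ K (k + 2) := by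
      refine isHomogeneous_monomial _ ?_
      simp [hd]
    have hMi : pderiv i (pderiv i M) = monomial d c := by
      have hexp : d + Finsupp.single i 2 - Finsupp.single i 1 - Finsupp.single i 1 = d := by
        rw [tsub_tsub, ← Finsupp.single_add, add_tsub_cancel_right]
      rw [hM, pderiv_monomial, pderiv_monomial, hexp]
      congr 1
      simp only [Finsupp.coe_add, Finsupp.coe_tsub, Pi.add_apply, Pi.sub_apply,
        Finsupp.single_eq_same, Nat.add_succ_sub_one]
      rw [mul_assoc, ← ha, div_mul_cancel₀ _ ha0]
    have hsum := partialLaplacian_apply s M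
    rw [← Finset.add_sum_erase s _ hi, hMi] at hsum
    rw [eq_sub_of_add_eq hsum.symm]
    refine sub_mem (Submodule.mem_map_of_mem hM_mem) (sum_mem fun j hj => ?_)
    have hji : j ≠ i := Finset.ne_of_mem_erase hj
    rw [hM, pderiv_monomial, pderiv_monomial]
    by_cases hdj : 2 ≤ d j
    · have hle : Finsupp.single j 2 ≤ d := by simpa using hdj
      obtain ⟨r, rfl⟩ := exists_add_of_le hle
      have hexp : Finsupp.single j 2 + r + Finsupp.single i 2 - Finsupp.single j 1
          - Finsupp.single j 1 = r + Finsupp.single i 2 := by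
        rw [tsub_tsub, ← Finsupp.single_add, add_assoc, add_tsub_cancel_left]
      rw [hexp]
      have hri : r i + 2 ≤ k := by
        have := Finsupp.le_degree i r
        simp at hd
        omega
      refine ih _ ?_ _ ?_ _ rfl
      · simp [hji] at h ⊢
        omega
      · simp at hd ⊢
        omega
    · have h0 : d j = 0 ∨ d j = 1 := by omega
      rcases h0 with h0 | h0 <;> simp [h0, hji]

theorem homogeneousSubmodule_le_map_partialLaplacian [CharZero K] {s : Finset σ}
    (hs : s.Nonempty) (k : ℕ) :
    homogeneousSubmodule σ K k ≤
      (homogeneousSubmodule σ K (k + 2)).map (partialLaplacian K s) := by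
  obtain ⟨i, hi⟩ := hs
  intro Q hQ
  rw [Q.as_sum]
  refine sum_mem fun d hd => monomial_mem_map_partialLaplacian hi k d ?_ _
  rw [Finsupp.degree_eq_weight_one]
  exact hQ (mem_support_iff.mp hd)

end MvPolynomial

/-- Surjectivity of the ultrahyperbolic operator on homogeneous polynomials:
for `k ≥ 2`, every homogeneous polynomial of degree `k − 2` is `𝓛 P` for some
homogeneous polynomial `P` of degree `k`. -/
theorem UH_surjective (n k : ℕ) (hn : 1 ≤ n) (hk : 2 ≤ k)
    (Q : MvPolynomial (Fin n ⊕ Fin n) ℂ)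
    (hQ : Q ∈ homogeneousSubmodule (Fin n ⊕ Fin n) ℂ (k - 2)) :
    ∃ P ∈ homogeneousSubmodule (Fin n ⊕ Fin n) ℂ k, UH n P = Q := by
  obtain ⟨m, rfl⟩ := Nat.exists_eq_add_of_le' hk
  rw [Nat.add_sub_cancel] at hQ
  have hne : (Finset.univ.map (Function.Embedding.inr : Fin n ↪ Fin n ⊕ Fin n)).Nonempty :=
    ⟨Sum.inr ⟨0, hn⟩, by simp⟩
  obtain ⟨P, hP, hPQ⟩ := homogeneousSubmodule_le_map_partialLaplacian hne m hQ
  rw [partialLaplacian_apply, Finset.sum_map] at hPQ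
  refine ⟨(4 : ℂ)⁻¹ • P, Submodule.smul_mem _ _ hP, ?_⟩
  simp only [UH, Derivation.map_smul, ← Finset.smul_sum]
  rw [smul_inv_smul₀ (by norm_num)]
  exact hPQ
end
end
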